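/- Structure of the space-time resonant sets: Let c > 0. For every choice of k,ℓ,m ∈ {1,c} and ε₀,ε₁,ε₂ ∈ {+1,−1}, the space-time resonant set R ⊂ ℝ³×ℝ³ of the phase φ(ξ,η) = ε₀⟨ξ⟩_k − ε₁⟨η⟩_ℓ − ε₂⟨ξ−η⟩_m is a finite (possibly empty) union of sets of the form {(λ_j η, η) : η ∈ ℝ³, |η| = R_j}; that is, there exists a finite set F ⊂ ℝ × ℝ such that R = ⋃_{(λ,r) ∈ F} {(λη, η) : η ∈ ℝ³, |η| = r}. -/

import Mathlib

open MeasureTheory Filter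
open scoped ENNReal

noncomputable section

abbrev R3 := EuclideanSpace ℝ (Fin 3)

/-- The phase `φ(ξ,η) = ε₀⟨ξ⟩_k − ε₁⟨η⟩_ℓ − ε₂⟨ξ−η⟩_m`, where `⟨ξ⟩_k = √(1+k²|ξ|²)`. -/
def phase (k l m e0 e1 e2 : ℝ) (ξ η : R3) : ℝ :=
  e0 * Real.sqrt (1 + k ^ 2 * ‖ξ‖ ^ 2) - e1 * Real.sqrt (1 + l ^ 2 * ‖η‖ ^ 2)
    - e2 * Real.sqrt (1 + m ^ 2 * ‖ξ - η‖ ^ 2)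

/-- The time-resonant set `T = {φ = 0}`. -/
def TimeRes (k l m e0 e1 e2 : ℝ) : Set (R3 × R3) :=
  {p | phase k l m e0 e1 e2 p.1 p.2 = 0}

/-- The space-resonant set `S = {∇_η φ = 0}`. -/
def SpaceRes (k l m e0 e1 e2 : ℝ) : Set (R3 × R3) :=
  {p | gradient (fun η => phase k l m e0 e1 e2 p.1 η) p.2 = 0}

/-- The space-time resonant set `R = S ∩ T`. -/
def SpaceTimeRes (k l m e0 e1 e2 : ℝ) : Set (R3 × R3) :=
  SpaceRes k l m e0 e1 e2 ∩ TimeRes k l m e0 e1 e2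


lemma finite_caseA (k l m : ℝ) (hl : 0 < l) (hm : 0 < m) (hkl : k = l) :
    {p : ℝ × ℝ | p.1 ≠ 0 ∧ p.2 ≠ 0 ∧ ∃ A B : ℝ, A ^ 2 = 1 + l ^ 2 * p.1 ^ 2 ∧
      B ^ 2 = 1 + m ^ 2 * p.2 ^ 2 ∧ m ^ 2 * p.2 * A = l ^ 2 * p.1 * B ∧
      1 + k ^ 2 * (p.1 + p.2) ^ 2 = (A + B) ^ 2}.Finite := by
  subst hkl
  let P : Polynomial ℝ :=
    (Polynomial.C (k ^ 2 - m ^ 2) * Polynomial.X ^ 2 - 1) ^ 2 *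
      (Polynomial.C (k ^ 2) + Polynomial.C (m ^ 2 * (k ^ 2 - m ^ 2)) * Polynomial.X ^ 2)
      - Polynomial.C (4 * k ^ 2)
  have hev : ∀ b, P.eval b = ((k ^ 2 - m ^ 2) * b ^ 2 - 1) ^ 2 *
      (k ^ 2 + m ^ 2 * (k ^ 2 - m ^ 2) * b ^ 2) - 4 * k ^ 2 := by
    intro b; simp [P]
  have hP : P ≠ 0 := by
    intro h
    have := hev 0
    rw [h] at this
    simp at this
    nlinarith [pow_pos hl 2]
  have hfin : {b : ℝ | P.IsRoot b}.Finite := Polynomial.finite_setOfPred_isRoot hP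
  refine (hfin.image (fun b => (m ^ 2 * b * ((k ^ 2 - m ^ 2) * b ^ 2 - 1) / (2 * k ^ 2), b))).subset ?_
  rintro ⟨a, b⟩ ⟨ha, hb, A, B, hA, hB, h1, h2⟩
  simp only at ha hb hA hB h1 h2
  have h3 : m ^ 2 * b * ((k ^ 2 - m ^ 2) * b ^ 2 - 1) = 2 * k ^ 2 * a := by
    linear_combination m ^ 2 * b * (h2 + hA + hB) + 2 * B * h1 + 2 * k ^ 2 * a * hB
  have h4 : m ^ 4 * b ^ 2 * (1 + k ^ 2 * a ^ 2) = k ^ 4 * a ^ 2 * (1 + m ^ 2 * b ^ 2) := by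
    rw [← hA, ← hB]
    linear_combination (m ^ 2 * b * A + k ^ 2 * a * B) * h1
  refine ⟨b, ?_, ?_⟩
  · show P.eval b = 0
    rw [hev]
    have hne : m ^ 4 * b ^ 2 ≠ 0 := by positivity
    apply mul_left_cancel₀ hne
    linear_combination (k ^ 2 + m ^ 2 * (k ^ 2 - m ^ 2) * b ^ 2) *
      (m ^ 2 * b * ((k ^ 2 - m ^ 2) * b ^ 2 - 1) + 2 * k ^ 2 * a) * h3 - 4 * k ^ 2 * h4
  · ext
    · simp only
      rw [h3]; field_simp
    · rfl

lemma finite_caseB (k l : ℝ) (hl : 0 < l) :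
    {p : ℝ × ℝ | p.1 ≠ 0 ∧ p.2 ≠ 0 ∧ ∃ A B : ℝ, A ^ 2 = 1 + l ^ 2 * p.1 ^ 2 ∧
      B ^ 2 = 1 + l ^ 2 * p.2 ^ 2 ∧ l ^ 2 * p.2 * A = l ^ 2 * p.1 * B ∧
      1 + k ^ 2 * (p.1 + p.2) ^ 2 = (A + B) ^ 2}.Finite := by
  let P : Polynomial ℝ := Polynomial.C (4 * (k ^ 2 - l ^ 2)) * Polynomial.X ^ 2 - 3
  have hev : ∀ b, P.eval b = 4 * (k ^ 2 - l ^ 2) * b ^ 2 - 3 := by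
    intro b; simp [P]
  have hP : P ≠ 0 := by
    intro h
    have := hev 0
    rw [h] at this
    simp at this
  have hfin : {b : ℝ | P.IsRoot b}.Finite := Polynomial.finite_setOfPred_isRoot hP
  refine (hfin.image (fun b => (b, b))).subset ?_
  rintro ⟨a, b⟩ ⟨ha, hb, A, B, hA, hB, h1, h2⟩
  simp only at ha hb hA hB h1 h2
  have h1' : b * A = a * B := by
    apply mul_left_cancel₀ (pow_pos hl 2).ne'
    linear_combination h1
  have hsq : (b - a) * (b + a) = 0 := by
    linear_combination (b * A + a * B) * h1' - b ^ 2 * hA + a ^ 2 * hB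
  rcases mul_eq_zero.1 hsq with h | h
  · have : b = a := by linarith
    subst this
    have hAB : A = B := mul_left_cancel₀ hb h1'
    subst hAB
    refine ⟨b, ?_, rfl⟩
    show P.eval b = 0
    rw [hev]
    linear_combination h2 + 4 * hA
  · exfalso
    have : b = -a := by linarith
    subst this
    have hAB : A = -B := mul_left_cancel₀ hb (by linarith)
    subst hAB
    norm_num at h2

lemma finite_Q (c : ℝ) (hc : 0 < c) (k l m : ℝ)
    (hk : k = 1 ∨ k = c) (hl : l = 1 ∨ l = c) (hm : m = 1 ∨ m = c) :
    {p : ℝ × ℝ | p.1 ≠ 0 ∧ p.2 ≠ 0 ∧ ∃ A B : ℝ, A ^ 2 = 1 + l ^ 2 * p.1 ^ 2 ∧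
      B ^ 2 = 1 + m ^ 2 * p.2 ^ 2 ∧ m ^ 2 * p.2 * A = l ^ 2 * p.1 * B ∧
      1 + k ^ 2 * (p.1 + p.2) ^ 2 = (A + B) ^ 2}.Finite := by
  have hl0 : 0 < l := by rcases hl with h | h <;> simp [h, hc]
  have hm0 : 0 < m := by rcases hm with h | h <;> simp [h, hc]
  by_cases h1 : k = l
  · exact finite_caseA k l m hl0 hm0 h1
  by_cases h2 : k = m
  · refine ((finite_caseA k m l hm0 hl0 h2).image Prod.swap).subset ?_
    rintro ⟨a, b⟩ ⟨ha, hb, A, B, hA, hB, h1, h2⟩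
    refine ⟨(b, a), ⟨hb, ha, B, A, hB, hA, h1.symm, ?_⟩, rfl⟩
    simp only at h2 ⊢
    linear_combination h2
  · have h3 : m = l := by grind
    subst h3
    exact finite_caseB k m hm0

lemma grad_phase (k l m e0 e1 e2 : ℝ) (ξ η : R3) :
    gradient (fun η => phase k l m e0 e1 e2 ξ η) η =
      (e2 * (m ^ 2 / Real.sqrt (1 + m ^ 2 * ‖ξ - η‖ ^ 2))) • (ξ - η)
       - (e1 * (l ^ 2 / Real.sqrt (1 + l ^ 2 * ‖η‖ ^ 2))) • η := by
  apply HasGradientAt.gradient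
  rw [hasGradientAt_iff_hasFDerivAt]
  have hid : HasFDerivAt (fun x : R3 => x) (ContinuousLinearMap.id ℝ R3) η := hasFDerivAt_id η
  have hA := ((hid.norm_sq.const_mul (l ^ 2)).const_add 1).sqrt (by positivity)
  have hB := (((hid.const_sub ξ).norm_sq.const_mul (m ^ 2)).const_add 1).sqrt (by positivity)
  have h := ((hA.const_mul e1).const_sub (e0 * Real.sqrt (1 + k ^ 2 * ‖ξ‖ ^ 2))).sub
    (hB.const_mul e2)
  refine HasFDerivAt.congr_fderiv h ?_
  ext v
  simp [inner_sub_left, inner_smul_left, -inner_self_eq_norm_sq_to_K]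
  have : Real.sqrt (1 + m ^ 2 * ‖ξ - η‖ ^ 2) ≠ 0 := by positivity
  have : Real.sqrt (1 + l ^ 2 * ‖η‖ ^ 2) ≠ 0 := by positivity
  field_simp
  ring

lemma key (c : ℝ) (hc : 0 < c) (k l m e0 e1 e2 : ℝ)
    (hk : k = 1 ∨ k = c) (hl : l = 1 ∨ l = c) (hm : m = 1 ∨ m = c)
    (he0 : e0 = 1 ∨ e0 = -1) (he1 : e1 = 1 ∨ e1 = -1) (he2 : e2 = 1 ∨ e2 = -1) :
    {p : ℝ × ℝ | 0 < p.2 ∧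
      e2 * (m ^ 2 / Real.sqrt (1 + m ^ 2 * ((p.1 - 1) * p.2) ^ 2)) * (p.1 - 1) =
        e1 * (l ^ 2 / Real.sqrt (1 + l ^ 2 * p.2 ^ 2)) ∧
      e0 * Real.sqrt (1 + k ^ 2 * (p.1 * p.2) ^ 2) - e1 * Real.sqrt (1 + l ^ 2 * p.2 ^ 2)
        - e2 * Real.sqrt (1 + m ^ 2 * ((p.1 - 1) * p.2) ^ 2) = 0}.Finite := by
  have hl0 : 0 < l := by rcases hl with h | h <;> simp [h, hc]
  refine ((finite_Q c hc k l m hk hl hm).image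
    (fun q => ((q.1 + q.2) / q.1, q.1))).subset ?_
  rintro ⟨t, r⟩ ⟨hr, h1, h2⟩
  simp only at hr h1 h2
  have hA0 : 0 < Real.sqrt (1 + l ^ 2 * r ^ 2) := by positivity
  have hB0 : 0 < Real.sqrt (1 + m ^ 2 * ((t - 1) * r) ^ 2) := by positivity
  have hA := Real.sq_sqrt (show 0 ≤ 1 + l ^ 2 * r ^ 2 by positivity)
  have hB := Real.sq_sqrt (show 0 ≤ 1 + m ^ 2 * ((t - 1) * r) ^ 2 by positivity)
  have hC := Real.sq_sqrt (show 0 ≤ 1 + k ^ 2 * (t * r) ^ 2 by positivity)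
  generalize Real.sqrt (1 + l ^ 2 * r ^ 2) = A at *
  generalize Real.sqrt (1 + m ^ 2 * ((t - 1) * r) ^ 2) = B at *
  generalize Real.sqrt (1 + k ^ 2 * (t * r) ^ 2) = C at *
  have s0 : e0 ^ 2 = 1 := by rcases he0 with h | h <;> simp [h]
  have s1 : e1 ^ 2 = 1 := by rcases he1 with h | h <;> simp [h]
  have s2 : e2 ^ 2 = 1 := by rcases he2 with h | h <;> simp [h]
  have ht : t - 1 ≠ 0 := by
    intro h
    rw [h, mul_zero] at h1
    have : e1 ≠ 0 := by rintro rfl; norm_num at s1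
    have : e1 * (l ^ 2 / A) ≠ 0 := mul_ne_zero this (by positivity)
    exact this h1.symm
  have h1' : e2 * m ^ 2 * (t - 1) * A = e1 * l ^ 2 * B := by
    field_simp at h1
    linear_combination h1
  refine ⟨(r, (t - 1) * r), ⟨hr.ne', mul_ne_zero ht hr.ne', e1 * A, e2 * B, ?_, ?_, ?_, ?_⟩, ?_⟩
  · simp only; linear_combination A ^ 2 * s1 + hA
  · simp only; linear_combination B ^ 2 * s2 + hB
  · simp only
    linear_combination e1 * e2 * r * h1' - m ^ 2 * (t - 1) * r * e1 * A * s2 + l ^ 2 * r * e2 * B * s1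
  · simp only
    linear_combination (e0 * C + e1 * A + e2 * B) * h2 - C ^ 2 * s0 - hC
  · ext
    · simp only; field_simp; ring
    · rfl

theorem stmt1 (c : ℝ) (hc : 0 < c) (k l m e0 e1 e2 : ℝ)
    (hk : k = 1 ∨ k = c) (hl : l = 1 ∨ l = c) (hm : m = 1 ∨ m = c)
    (he0 : e0 = 1 ∨ e0 = -1) (he1 : e1 = 1 ∨ e1 = -1) (he2 : e2 = 1 ∨ e2 = -1) :
    ∃ F : Finset (ℝ × ℝ),
      SpaceTimeRes k l m e0 e1 e2
        = ⋃ lr ∈ F, {p : R3 × R3 | p.1 = lr.1 • p.2 ∧ ‖p.2‖ = lr.2} := by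
  have hm0 : 0 < m := by rcases hm with h | h <;> simp [h, hc]
  refine ⟨(key c hc k l m e0 e1 e2 hk hl hm he0 he1 he2).toFinset, ?_⟩
  have hn1 : ∀ (t : ℝ) (η : R3), ‖t • η‖ ^ 2 = (t * ‖η‖) ^ 2 := by
    intro t η
    rw [norm_smul, mul_pow, mul_pow, Real.norm_eq_abs, sq_abs]
  have hn2 : ∀ (t : ℝ) (η : R3), t • η - η = (t - 1) • η := by
    intro t η; rw [sub_smul, one_smul]
  ext ⟨ξ, η⟩
  simp only [SpaceTimeRes, SpaceRes, TimeRes, Set.mem_inter_iff, Set.mem_setOf_eq, Set.mem_iUnion,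
    Set.Finite.mem_toFinset, grad_phase, exists_prop]
  constructor
  · rintro ⟨h1, h2⟩
    have hcoef : e2 * (m ^ 2 / Real.sqrt (1 + m ^ 2 * ‖ξ - η‖ ^ 2)) ≠ 0 := by
      have : e2 ≠ 0 := by rcases he2 with h | h <;> simp [h]
      exact mul_ne_zero this (by positivity)
    obtain ⟨t, rfl⟩ : ∃ t : ℝ, ξ = t • η := by
      generalize e2 * (m ^ 2 / Real.sqrt (1 + m ^ 2 * ‖ξ - η‖ ^ 2)) = a at *
      generalize e1 * (l ^ 2 / Real.sqrt (1 + l ^ 2 * ‖η‖ ^ 2)) = b at *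
      refine ⟨1 + a⁻¹ * b, ?_⟩
      have h3 : ξ - η = a⁻¹ • (b • η) := by
        rw [← sub_eq_zero.1 h1, smul_smul, inv_mul_cancel₀ hcoef, one_smul]
      rw [add_smul, one_smul, ← smul_smul, ← h3]; abel
    have hη : η ≠ 0 := by
      rintro rfl
      simp [phase] at h2
      rcases he0 with rfl | rfl <;> rcases he1 with rfl | rfl <;> rcases he2 with rfl | rfl <;>
        norm_num at h2
    refine ⟨(t, ‖η‖), ⟨norm_pos_iff.2 hη, ?_, ?_⟩, rfl, rfl⟩
    · rw [hn2, smul_smul, ← sub_smul, smul_eq_zero, hn1] at h1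
      exact sub_eq_zero.1 (h1.resolve_right hη)
    · rw [phase, hn2, hn1, hn1] at h2
      exact h2
  · rintro ⟨⟨t, r⟩, ⟨hr, h1, h2⟩, h3, h4⟩
    simp only at hr h1 h2 h3 h4
    subst h3 h4
    refine ⟨?_, ?_⟩
    · rw [hn2, smul_smul, ← sub_smul, hn1, h1, sub_self, zero_smul]
    · rw [phase, hn2, hn1, hn1]
      exact h2
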